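/- arXiv:2404.04766 — 9 statements merged into one kernel-verified Lean document; each statement's English description precedes it below -/
import Mathlib

section
/- Let 𝒮 be a class of subsets of a set X such that ∅ ∈ 𝒮, 𝒮 is closed under arbitrary nonempty unions (the union of any nonempty subclass of 𝒮 belongs to 𝒮), and 𝒮 is closed under set differences (a complete ring of sets). Then: (i) every nonempty S ∈ 𝒮 is the union of the atoms of 𝒮 contained in S, and these atoms partition S; (ii) the map φ sending each S ∈ 𝒮 to the class of atoms of 𝒮 contained in S is a bijection from 𝒮 onto the power set of the class of atoms of 𝒮, and φ preserves arbitrary unions and intersections. -/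
/-- In a complete ring of sets, removing from `S` every member that misses a point `x` of `S`
leaves an atom containing `x`. -/
theorem exists_ring_atom_mem {X : Type*} {𝒮 : Set (Set X)}
    (hempty : ∅ ∈ 𝒮)
    (hdiff : ∀ s ∈ 𝒮, ∀ t ∈ 𝒮, s \ t ∈ 𝒮)
    (hUnion : ∀ C : Set (Set X), C ⊆ 𝒮 → C.Nonempty → ⋃₀ C ∈ 𝒮)
    {S : Set X} (hS : S ∈ 𝒮) {x : X} (hx : x ∈ S) :
    ∃ A, (A ∈ 𝒮 ∧ A.Nonempty ∧ ∀ B ∈ 𝒮, B ⊆ A → B = ∅ ∨ B = A) ∧ x ∈ A ∧ A ⊆ S := by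
  let U : Set X := ⋃₀ {T | T ∈ 𝒮 ∧ x ∉ T}
  have hUmem : U ∈ 𝒮 := hUnion _ (fun T hT => hT.1) ⟨∅, hempty, Set.notMem_empty x⟩
  have hsub : ∀ T ∈ 𝒮, x ∉ T → T ⊆ U := fun T hT hxT => Set.subset_sUnion_of_mem ⟨hT, hxT⟩
  have hxU : x ∉ U := by
    rintro ⟨T, hT, hxT⟩
    exact hT.2 hxT
  have hA : S \ U ∈ 𝒮 := hdiff S hS U hUmem
  refine ⟨S \ U, ⟨hA, ⟨x, hx, hxU⟩, fun B hB hBA => ?_⟩, ⟨hx, hxU⟩, Set.sdiff_subset⟩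
  by_cases hxB : x ∈ B
  · refine Or.inr (hBA.antisymm fun y hy => ?_)
    by_contra hyB
    exact hy.2 (hsub _ (hdiff _ hA _ hB) (fun h => h.2 hxB) ⟨hy, hyB⟩)
  · exact Or.inl (Set.eq_empty_of_forall_notMem fun y hy => (hBA hy).2 (hsub B hB hxB hy))

/-- An atom that meets a member of the ring is contained in it. -/
theorem ring_atom_subset_of_mem {X : Type*} {𝒮 : Set (Set X)}
    (hdiff : ∀ s ∈ 𝒮, ∀ t ∈ 𝒮, s \ t ∈ 𝒮)
    {A T : Set X} (hA : A ∈ 𝒮) (hmin : ∀ B ∈ 𝒮, B ⊆ A → B = ∅ ∨ B = A)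
    (hT : T ∈ 𝒮) {x : X} (hxA : x ∈ A) (hxT : x ∈ T) : A ⊆ T := by
  rcases hmin _ (hdiff A hA T hT) Set.sdiff_subset with h | h
  · exact Set.sdiff_eq_empty.mp h
  · exact absurd hxT (h.symm.subset hxA).2

/-- Let `𝒮` be a complete ring of sets on `X`: `∅ ∈ 𝒮`, `𝒮` is closed
under set differences, and `𝒮` is closed under arbitrary nonempty unions.  Let `Atoms`
be the class of atoms of `𝒮` (nonempty members of `𝒮` properly containing no nonempty
member of `𝒮`) and let `φ` send each set `S` to the class of atoms contained in `S`.
Then: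
(i) every nonempty `S ∈ 𝒮` is the union of the atoms contained in it, and those atoms
are pairwise disjoint (they partition `S`);
(ii) `φ` is a bijection from `𝒮` onto the power set of `Atoms`, preserving arbitrary
(nonempty) unions and intersections. -/
theorem stmt6 {X : Type*} (𝒮 : Set (Set X))
    (hempty : ∅ ∈ 𝒮)
    (hdiff : ∀ s ∈ 𝒮, ∀ t ∈ 𝒮, s \ t ∈ 𝒮)
    (hUnion : ∀ C : Set (Set X), C ⊆ 𝒮 → C.Nonempty → ⋃₀ C ∈ 𝒮) :
    let Atoms : Set (Set X) :=
      {A | A ∈ 𝒮 ∧ A.Nonempty ∧ ∀ B ∈ 𝒮, B ⊆ A → B = ∅ ∨ B = A}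
    let φ : Set X → Set (Set X) := fun S => {A | A ∈ Atoms ∧ A ⊆ S}
    (∀ S ∈ 𝒮, S.Nonempty →
        ⋃₀ (φ S) = S ∧ (∀ A ∈ φ S, ∀ B ∈ φ S, A ≠ B → Disjoint A B)) ∧
    Set.BijOn φ 𝒮 (Set.powerset Atoms) ∧
    (∀ C : Set (Set X), C ⊆ 𝒮 → C.Nonempty →
        φ (⋃₀ C) = ⋃₀ (φ '' C) ∧ φ (⋂₀ C) = ⋂₀ (φ '' C)) := by
  intro Atoms φ
  have hsub : ∀ A ∈ Atoms, ∀ T ∈ 𝒮, ∀ x ∈ A, x ∈ T → A ⊆ T :=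
    fun A hA T hT x hxA hxT => ring_atom_subset_of_mem hdiff hA.1 hA.2.2 hT hxA hxT
  have hcover : ∀ S ∈ 𝒮, ⋃₀ (φ S) = S := by
    intro S hS
    refine (Set.sUnion_subset fun A hA => hA.2).antisymm fun x hx => ?_
    obtain ⟨A, hA, hxA, hAS⟩ := exists_ring_atom_mem hempty hdiff hUnion hS hx
    exact ⟨A, ⟨hA, hAS⟩, hxA⟩
  refine ⟨fun S hS _ => ⟨hcover S hS, fun A hA B hB hne => ?_⟩, ⟨fun S _ A hA => hA.1, ?_, ?_⟩,
    fun C hC hne => ⟨?_, ?_⟩⟩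
  · refine Set.disjoint_left.mpr fun x hxA hxB => hne ?_
    exact (hsub A hA.1 B hB.1.1 x hxA hxB).antisymm (hsub B hB.1 A hA.1.1 x hxB hxA)
  · intro S hS T hT hST
    rw [← hcover S hS, hST, hcover T hT]
  · intro 𝒜 h𝒜
    have hmem : ⋃₀ 𝒜 ∈ 𝒮 := by
      rcases 𝒜.eq_empty_or_nonempty with rfl | h
      · rwa [Set.sUnion_empty]
      · exact hUnion 𝒜 (fun A hA => (h𝒜 hA).1) h
    refine ⟨⋃₀ 𝒜, hmem, Set.Subset.antisymm ?_ fun A hA => ⟨h𝒜 hA, Set.subset_sUnion_of_mem hA⟩⟩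
    rintro A ⟨hA, hAU⟩
    obtain ⟨x, hxA⟩ := hA.2.1
    obtain ⟨B, hB, hxB⟩ := hAU hxA
    have hAB : A = B := (hsub A hA B (h𝒜 hB).1 x hxA hxB).antisymm
      (hsub B (h𝒜 hB) A hA.1 x hxB hxA)
    rwa [hAB]
  · refine Set.Subset.antisymm ?_ ?_
    · rintro A ⟨hA, hAU⟩
      obtain ⟨x, hxA⟩ := hA.2.1
      obtain ⟨T, hT, hxT⟩ := hAU hxA
      exact ⟨φ T, ⟨T, hT, rfl⟩, hA, hsub A hA T (hC hT) x hxA hxT⟩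
    · rintro A ⟨_, ⟨T, hT, rfl⟩, hA, hAT⟩
      exact ⟨hA, hAT.trans (Set.subset_sUnion_of_mem hT)⟩
  · refine Set.Subset.antisymm ?_ fun A hA => ?_
    · rintro A ⟨hA, hAI⟩ _ ⟨T, hT, rfl⟩
      exact ⟨hA, hAI.trans (Set.sInter_subset_of_mem hT)⟩
    · obtain ⟨T, hT⟩ := hne
      exact ⟨(hA (φ T) ⟨T, hT, rfl⟩).1,
        Set.subset_sInter fun T hT => (hA (φ T) ⟨T, hT, rfl⟩).2⟩
end

section
/- Let 𝒮 be a lattice of sets on X. Then a subset S of X is the limit of some sequence of members of 𝒮 (i.e. limsup Sᵢ = liminf Sᵢ = S for some sequence (Sᵢ) in 𝒮) if and only if S belongs both to 𝒮_σδ (S is a countable intersection of countable unions of members of 𝒮) and to 𝒮_δσ (S is a countable union of countable intersections of members of 𝒮). -/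
/-- The class `𝒮_σ` of countable unions of members of `𝒮`. -/
def ctblUnions {X : Type*} (𝒮 : Set (Set X)) : Set (Set X) :=
  {A | ∃ f : ℕ → Set X, (∀ i, f i ∈ 𝒮) ∧ A = ⋃ i, f i}

/-- The class `𝒮_δ` of countable intersections of members of `𝒮`. -/
def ctblInters {X : Type*} (𝒮 : Set (Set X)) : Set (Set X) :=
  {A | ∃ f : ℕ → Set X, (∀ i, f i ∈ 𝒮) ∧ A = ⋂ i, f i}

theorem iUnion_le_mem_of_union_closed {X : Type*} {𝒮 : Set (Set X)}
    (hunion : ∀ s ∈ 𝒮, ∀ t ∈ 𝒮, s ∪ t ∈ 𝒮) {f : ℕ → Set X} (hf : ∀ i, f i ∈ 𝒮) (n : ℕ) :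
    (⋃ i ≤ n, f i) ∈ 𝒮 := by
  induction n with
  | zero => simpa using hf 0
  | succ n ih =>
    rw [Set.biUnion_le_succ]
    exact hunion _ ih _ (hf _)

theorem iInter_le_mem_of_inter_closed {X : Type*} {𝒮 : Set (Set X)}
    (hinter : ∀ s ∈ 𝒮, ∀ t ∈ 𝒮, s ∩ t ∈ 𝒮) {f : ℕ → Set X} (hf : ∀ i, f i ∈ 𝒮) (n : ℕ) :
    (⋂ i ≤ n, f i) ∈ 𝒮 := by
  induction n with
  | zero => simpa using hf 0
  | succ n ih =>
    rw [Set.biInter_le_succ]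
    exact hinter _ ih _ (hf _)

theorem limsup_mem_ctblInters_ctblUnions {X : Type*} {𝒮 : Set (Set X)} {f : ℕ → Set X}
    (hf : ∀ i, f i ∈ 𝒮) :
    (⋂ i, ⋃ m, ⋃ (_ : i ≤ m), f m) ∈ ctblInters (ctblUnions 𝒮) :=
  ⟨_, fun i => ⟨fun m => f (i + m), fun _ => hf _, by
    ext x
    simp only [Set.mem_iUnion, exists_prop, le_iff_exists_add]
    grind⟩, rfl⟩

theorem liminf_mem_ctblUnions_ctblInters {X : Type*} {𝒮 : Set (Set X)} {f : ℕ → Set X}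
    (hf : ∀ i, f i ∈ 𝒮) :
    (⋃ i, ⋂ m, ⋂ (_ : i ≤ m), f m) ∈ ctblUnions (ctblInters 𝒮) :=
  ⟨_, fun i => ⟨fun m => f (i + m), fun _ => hf _, by
    ext x
    simp only [Set.mem_iInter, le_iff_exists_add]
    grind⟩, rfl⟩

/-- If eventual membership in `f` is decided by membership in `S`, then `f` converges to `S`. -/
theorem limsup_eq_and_liminf_eq {X : Type*} {f : ℕ → Set X} {S : Set X}
    (hmem : ∀ x ∈ S, ∃ N, ∀ n ≥ N, x ∈ f n) (hnot : ∀ x ∉ S, ∃ N, ∀ n ≥ N, x ∉ f n) :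
    (⋂ i, ⋃ m, ⋃ (_ : i ≤ m), f m) = S ∧ (⋃ i, ⋂ m, ⋂ (_ : i ≤ m), f m) = S := by
  constructor
  · ext x
    simp only [Set.mem_iInter, Set.mem_iUnion, exists_prop]
    constructor
    · intro h
      by_contra hx
      obtain ⟨N, hN⟩ := hnot x hx
      obtain ⟨m, hm, hxm⟩ := h N
      exact hN m hm hxm
    · intro hx i
      obtain ⟨N, hN⟩ := hmem x hx
      exact ⟨max i N, le_max_left _ _, hN _ (le_max_right _ _)⟩
  · ext x
    simp only [Set.mem_iInter, Set.mem_iUnion]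
    constructor
    · rintro ⟨i, h⟩
      by_contra hx
      obtain ⟨N, hN⟩ := hnot x hx
      exact hN (max i N) (le_max_right _ _) (h _ (le_max_left _ _))
    · exact hmem x

/-- Let `𝒮` be a lattice of sets on `X` (containing `∅`, closed under
pairwise unions and pairwise intersections).  Then `S ⊆ X` is the limit of a sequence
of members of `𝒮` (i.e. `limsup Sᵢ = liminf Sᵢ = S`) if and only if `S` belongs to both
`𝒮_σδ` and `𝒮_δσ`. -/
theorem stmt9 {X : Type*} (𝒮 : Set (Set X))
    (hempty : ∅ ∈ 𝒮)
    (hunion : ∀ s ∈ 𝒮, ∀ t ∈ 𝒮, s ∪ t ∈ 𝒮)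
    (hinter : ∀ s ∈ 𝒮, ∀ t ∈ 𝒮, s ∩ t ∈ 𝒮)
    (S : Set X) :
    (∃ f : ℕ → Set X, (∀ i, f i ∈ 𝒮) ∧
        (⋂ i, ⋃ m, ⋃ (_ : i ≤ m), f m) = S ∧
        (⋃ i, ⋂ m, ⋂ (_ : i ≤ m), f m) = S) ↔
      (S ∈ ctblInters (ctblUnions 𝒮) ∧ S ∈ ctblUnions (ctblInters 𝒮)) := by
  constructor
  · rintro ⟨f, hf, hsup, hinf⟩
    exact ⟨hsup ▸ limsup_mem_ctblInters_ctblUnions hf,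
      hinf ▸ liminf_mem_ctblUnions_ctblInters hf⟩
  · rintro ⟨⟨A, hA, hSA⟩, ⟨B, hB, hSB⟩⟩
    choose a ha hAa using hA
    choose b hb hBb using hB
    have hS_a : ∀ x, x ∈ S ↔ ∀ i, ∃ l, x ∈ a i l := by simp [hSA, hAa]
    have hS_b : ∀ x, x ∈ S ↔ ∃ j, ∀ k, x ∈ b j k := by simp [hSB, hBb]
    refine ⟨fun n => ⋃ j ≤ n, (⋂ k ≤ n, b j k) ∩ ⋂ i ≤ j, ⋃ l ≤ n, a i l, fun n => ?_,
      limsup_eq_and_liminf_eq (fun x hx => ?_) (fun x hx => ?_)⟩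
    · exact iUnion_le_mem_of_union_closed hunion (fun j => hinter _
        (iInter_le_mem_of_inter_closed hinter (hb j) n) _
        (iInter_le_mem_of_inter_closed hinter
          (fun i => iUnion_le_mem_of_union_closed hunion (ha i) n) j)) n
    · obtain ⟨j, hj⟩ := (hS_b x).1 hx
      choose l hl using (hS_a x).1 hx
      obtain ⟨M, hM⟩ := ((Set.finite_Iic j).image l).bddAbove
      refine ⟨max j M, fun n hn => ?_⟩
      simp only [Set.mem_iUnion, Set.mem_inter_iff, Set.mem_iInter, exists_prop]
      exact ⟨j, (le_max_left _ _).trans hn, fun k _ => hj k, fun i hi =>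
        ⟨l i, (hM ⟨i, hi, rfl⟩).trans ((le_max_right _ _).trans hn), hl i⟩⟩
    · have hi₀ := mt (hS_a x).2 hx
      have hk := mt (hS_b x).2 hx
      push Not at hi₀ hk
      obtain ⟨i₀, hi₀⟩ := hi₀
      choose k hk using hk
      obtain ⟨M, hM⟩ := ((Set.finite_Iic i₀).image k).bddAbove
      refine ⟨M, fun n hn hxn => ?_⟩
      simp only [Set.mem_iUnion, Set.mem_inter_iff, Set.mem_iInter, exists_prop] at hxn
      obtain ⟨j, -, hjb, hja⟩ := hxn
      rcases le_total i₀ j with h | h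
      · obtain ⟨l, -, hl⟩ := hja i₀ h
        exact hi₀ l hl
      · exact hk j (hjb _ ((hM ⟨j, h, rfl⟩).trans hn))
end

section
/- Let 𝒮 be a lattice of sets on X. If A is a countable union of members of 𝒮, B is a countable intersection of members of 𝒮, and A ⊇ B, then there exists a set S ⊆ X that is simultaneously a countable union of members of 𝒮 and a countable intersection of members of 𝒮, with A ⊇ S ⊇ B. -/
theorem iUnion_inter_biInter_le_eq_iInter_union_biUnion_lt {X : Type*} (a b : ℕ → Set X)
    (hba : ⋂ i, b i ⊆ ⋃ i, a i) :
    ⋃ n, (a n ∩ ⋂ i ≤ n, b i) = ⋂ n, (b n ∪ ⋃ i < n, a i) := by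
  ext x
  simp only [Set.mem_iUnion, Set.mem_inter_iff, Set.mem_iInter, Set.mem_union, exists_prop]
  constructor
  · rintro ⟨n, hn, hb⟩ m
    rcases le_or_gt m n with h | h
    · exact Or.inl (hb m h)
    · exact Or.inr ⟨n, h, hn⟩
  · intro h
    classical
    by_cases hx : ∀ i, x ∈ b i
    · obtain ⟨n, hn⟩ := Set.mem_iUnion.1 (hba (Set.mem_iInter.2 hx))
      exact ⟨n, hn, fun i _ => hx i⟩
    · have hx' : ∃ i, x ∉ b i := not_forall.1 hx
      obtain ⟨i, hi, hxi⟩ := (h (Nat.find hx')).resolve_left (Nat.find_spec hx')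
      exact ⟨i, hxi, fun j hj => not_not.1 (Nat.find_min hx' (hj.trans_lt hi))⟩

theorem biInter_le_mem_of_inter_mem {X : Type*} {𝒮 : Set (Set X)}
    (hinter : ∀ s ∈ 𝒮, ∀ t ∈ 𝒮, s ∩ t ∈ 𝒮) {b : ℕ → Set X} (hb : ∀ i, b i ∈ 𝒮) (n : ℕ) :
    ⋂ i ≤ n, b i ∈ 𝒮 := by
  induction n with
  | zero => simpa using hb 0
  | succ n ih =>
    rw [Set.biInter_le_succ]
    exact hinter _ ih _ (hb _)

theorem biUnion_lt_mem_of_union_mem {X : Type*} {𝒮 : Set (Set X)} (hempty : ∅ ∈ 𝒮)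
    (hunion : ∀ s ∈ 𝒮, ∀ t ∈ 𝒮, s ∪ t ∈ 𝒮) {a : ℕ → Set X} (ha : ∀ i, a i ∈ 𝒮) (n : ℕ) :
    ⋃ i < n, a i ∈ 𝒮 := by
  induction n with
  | zero => simpa using hempty
  | succ n ih =>
    rw [Set.biUnion_lt_succ]
    exact hunion _ ih _ (ha _)

/-- Let `𝒮` be a lattice of sets on `X` (containing `∅`, closed under
pairwise unions and pairwise intersections).  If `A ∈ 𝒮_σ`, `B ∈ 𝒮_δ` and `A ⊇ B`,
then there is a set `S ∈ 𝒮_σ ∩ 𝒮_δ` with `A ⊇ S ⊇ B`. -/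
theorem stmt10 {X : Type*} (𝒮 : Set (Set X))
    (hempty : ∅ ∈ 𝒮)
    (hunion : ∀ s ∈ 𝒮, ∀ t ∈ 𝒮, s ∪ t ∈ 𝒮)
    (hinter : ∀ s ∈ 𝒮, ∀ t ∈ 𝒮, s ∩ t ∈ 𝒮)
    (A B : Set X) (hA : A ∈ ctblUnions 𝒮) (hB : B ∈ ctblInters 𝒮) (hBA : B ⊆ A) :
    ∃ S : Set X, S ∈ ctblUnions 𝒮 ∧ S ∈ ctblInters 𝒮 ∧ B ⊆ S ∧ S ⊆ A := by
  obtain ⟨a, ha, rfl⟩ := hA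
  obtain ⟨b, hb, rfl⟩ := hB
  have heq := iUnion_inter_biInter_le_eq_iInter_union_biUnion_lt a b hBA
  refine ⟨⋃ n, (a n ∩ ⋂ i ≤ n, b i),
    ⟨_, fun n => hinter _ (ha n) _ (biInter_le_mem_of_inter_mem hinter hb n), rfl⟩,
    ⟨_, fun n => hunion _ (hb n) _ (biUnion_lt_mem_of_union_mem hempty hunion ha n), heq⟩,
    ?_, Set.iUnion_mono fun n => Set.inter_subset_left⟩
  rw [heq]
  exact Set.iInter_mono fun n => Set.subset_union_left
end

section
/- Let 𝒮 be a class of subsets of a set X. If 𝒮 is countably compact, then the class of all finite unions of countable intersections of members of 𝒮 is countably compact. If 𝒮 is compact, then the class of all finite unions of arbitrary (nonempty) intersections of members of 𝒮 is compact. -/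
/-- A class of sets has the finite intersection property if every (nonempty) finite
subclass has nonempty intersection. -/
def HasFIP {X : Type*} (C : Set (Set X)) : Prop :=
  ∀ F : Set (Set X), F ⊆ C → F.Finite → F.Nonempty → (⋂₀ F).Nonempty

/-- A class `𝒮` is compact if every nonempty subclass of `𝒮` with the finite
intersection property has nonempty intersection. -/
def IsCompactClass {X : Type*} (𝒮 : Set (Set X)) : Prop :=
  ∀ C : Set (Set X), C ⊆ 𝒮 → C.Nonempty → HasFIP C → (⋂₀ C).Nonempty

/-- A class `𝒮` is countably compact if every nonempty countable subclass of `𝒮` with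
the finite intersection property has nonempty intersection. -/
def IsCountablyCompactClass {X : Type*} (𝒮 : Set (Set X)) : Prop :=
  ∀ C : Set (Set X), C ⊆ 𝒮 → C.Countable → C.Nonempty → HasFIP C → (⋂₀ C).Nonempty

/-- Arbitrary (nonempty) intersections of members of `𝒮`. -/
def arbInters {X : Type*} (𝒮 : Set (Set X)) : Set (Set X) :=
  {A | ∃ C : Set (Set X), C ⊆ 𝒮 ∧ C.Nonempty ∧ A = ⋂₀ C}

/-- Finite (nonempty) unions of members of `𝒮`. -/
def finUnions {X : Type*} (𝒮 : Set (Set X)) : Set (Set X) :=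
  {A | ∃ (n : ℕ) (f : Fin (n + 1) → Set X), (∀ i, f i ∈ 𝒮) ∧ A = ⋃ i, f i}

theorem HasFIP.exists_ultrafilter {X : Type*} {C : Set (Set X)} (hC : HasFIP C)
    (hne : C.Nonempty) : ∃ U : Ultrafilter X, ∀ A ∈ C, A ∈ U := by
  have : (Filter.generate C).NeBot := by
    refine Filter.generate_neBot_iff.2 fun F hFC hF => ?_
    rcases F.eq_empty_or_nonempty with rfl | hF'
    · obtain ⟨A, hA⟩ := hne
      exact (hC {A} (by simpa using hA) (Set.finite_singleton A)
        (Set.singleton_nonempty A)).mono (by simp)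
    · exact hC F hFC hF hF'
  exact ⟨Ultrafilter.of (Filter.generate C), fun A hA =>
    Ultrafilter.of_le _ (Filter.mem_generate_of_mem hA)⟩

theorem Ultrafilter.hasFIP {X : Type*} (U : Ultrafilter X) {C : Set (Set X)}
    (hC : ∀ A ∈ C, A ∈ U) : HasFIP C := fun _ hFC hF _ =>
  U.nonempty_of_mem ((Filter.sInter_mem hF).2 fun A hA => hC A (hFC hA))

/-- A class of finite unions of intersections with the finite intersection property can be
refined, by choosing one intersection from each union, to a class of members of `𝒮` that
still has the finite intersection property. -/
theorem HasFIP.exists_refinement {X : Type*} {𝒮 T C : Set (Set X)} {p : Set (Set X) → Prop}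
    (hT : ∀ B ∈ T, ∃ D ⊆ 𝒮, D.Nonempty ∧ p D ∧ B = ⋂₀ D) (hCT : C ⊆ finUnions T)
    (hne : C.Nonempty) (hC : HasFIP C) :
    ∃ D : C → Set (Set X), (⋃ A, D A) ⊆ 𝒮 ∧ (⋃ A, D A).Nonempty ∧ (∀ A, p (D A)) ∧
      ⋂₀ (⋃ A, D A) ⊆ ⋂₀ C ∧ HasFIP (⋃ A, D A) := by
  obtain ⟨U, hU⟩ := hC.exists_ultrafilter hne
  have key : ∀ A : C, ∃ D ⊆ 𝒮, D.Nonempty ∧ p D ∧ ⋂₀ D ⊆ A.1 ∧ ∀ B ∈ D, B ∈ U := by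
    rintro ⟨A, hA⟩
    obtain ⟨n, f, hf, rfl⟩ := hCT hA
    have hmem := hU _ hA
    rw [← Set.biUnion_univ, Ultrafilter.finite_biUnion_mem_iff Set.finite_univ] at hmem
    obtain ⟨i, -, hi⟩ := hmem
    obtain ⟨D, hDS, hD, hp, hfD⟩ := hT _ (hf i)
    exact ⟨D, hDS, hD, hp, hfD ▸ Set.subset_iUnion f i, fun B hB =>
      Filter.mem_of_superset hi (hfD ▸ Set.sInter_subset_of_mem hB)⟩
  choose D hDS hD hp hDA hDU using key
  refine ⟨D, Set.iUnion_subset hDS, ?_, hp, ?_, U.hasFIP fun B hB => ?_⟩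
  · obtain ⟨A, hA⟩ := hne
    exact (hD ⟨A, hA⟩).mono (Set.subset_iUnion D _)
  · exact Set.subset_sInter fun A hA =>
      (Set.sInter_subset_sInter (Set.subset_iUnion D ⟨A, hA⟩)).trans (hDA ⟨A, hA⟩)
  · obtain ⟨A, hBA⟩ := Set.mem_iUnion.1 hB
    exact hDU A B hBA

/-- If `𝒮` is countably compact, then the class of all finite unions
of countable intersections of members of `𝒮` is countably compact.  If `𝒮` is compact,
then the class of all finite unions of arbitrary (nonempty) intersections of members of
`𝒮` is compact. -/
theorem stmt13 {X : Type*} (𝒮 : Set (Set X)) :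
    (IsCountablyCompactClass 𝒮 →
      IsCountablyCompactClass (finUnions (ctblInters 𝒮))) ∧
    (IsCompactClass 𝒮 → IsCompactClass (finUnions (arbInters 𝒮))) := by
  constructor
  · intro h𝒮 C hCT hCc hne hC
    obtain ⟨D, hDS, hD, hDc, hDC, hfip⟩ := hC.exists_refinement (𝒮 := 𝒮) (p := Set.Countable)
      (by
        rintro _ ⟨f, hf, rfl⟩
        exact ⟨Set.range f, Set.range_subset_iff.2 hf, Set.range_nonempty f,
          Set.countable_range f, (Set.sInter_range f).symm⟩) hCT hne
    have := hCc.to_subtype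
    exact (h𝒮 _ hDS (Set.countable_iUnion hDc) hD hfip).mono hDC
  · intro h𝒮 C hCT hne hC
    obtain ⟨D, hDS, hD, -, hDC, hfip⟩ := hC.exists_refinement (𝒮 := 𝒮) (p := fun _ => True)
      (by
        rintro _ ⟨D, hDS, hD, rfl⟩
        exact ⟨D, hDS, hD, trivial, rfl⟩) hCT hne
    exact (h𝒮 _ hDS hD hfip).mono hDC
end

section
/- Let X be a set of cardinality at most ℵ₀ and let 𝒮 be any nonempty class of subsets of X. Then 𝒮_σδ = 𝒮_δσ: a subset of X is a countable intersection of countable unions of members of 𝒮 if and only if it is a countable union of countable intersections of members of 𝒮. -/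
/-- On a countable type, a countable intersection of countable unions distributes into a union
over countably many choice functions. -/
theorem exists_iInter_iUnion_eq_iUnion_iInter {X : Type*} [Countable X] (s : ℕ → ℕ → Set X) :
    ∃ c : ℕ → ℕ → ℕ, ⋂ n, ⋃ m, s n m = ⋃ k, ⋂ n, s n (c k n) := by
  obtain ⟨e, he⟩ := exists_surjective_nat (Option X)
  have key : ∀ k, ∃ g : ℕ → ℕ, ∀ x, e k = some x → x ∈ ⋂ n, ⋃ m, s n m → ∀ n, x ∈ s n (g n) := by
    intro k
    by_cases h : ∃ x, e k = some x ∧ x ∈ ⋂ n, ⋃ m, s n m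
    · obtain ⟨x, hx, hxs⟩ := h
      simp only [Set.mem_iInter, Set.mem_iUnion] at hxs
      choose g hg using hxs
      refine ⟨g, fun y hy _ n => ?_⟩
      obtain rfl : x = y := Option.some.inj (hx.symm.trans hy)
      exact hg n
    · exact ⟨0, fun x hx hxs => absurd ⟨x, hx, hxs⟩ h⟩
  choose c hc using key
  refine ⟨c, Set.Subset.antisymm (fun x hx => ?_) (Set.iUnion_subset fun k => ?_)⟩
  · obtain ⟨k, hk⟩ := he (some x)
    exact Set.mem_iUnion.2 ⟨k, Set.mem_iInter.2 (hc k x hk hx)⟩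
  · exact Set.iInter_mono fun n => Set.subset_iUnion (s n) (c k n)

/-- On a countable type, a countable union of countable intersections distributes into an
intersection over countably many choice functions. -/
theorem exists_iUnion_iInter_eq_iInter_iUnion {X : Type*} [Countable X] (s : ℕ → ℕ → Set X) :
    ∃ c : ℕ → ℕ → ℕ, ⋃ n, ⋂ m, s n m = ⋂ k, ⋃ n, s n (c k n) := by
  obtain ⟨c, hc⟩ := exists_iInter_iUnion_eq_iUnion_iInter fun n m => (s n m)ᶜ
  refine ⟨c, compl_injective ?_⟩
  simpa only [Set.compl_iUnion, Set.compl_iInter] using hc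

/-- If `X` has cardinality at most `ℵ₀`, then for every nonempty
class `𝒮` of subsets of `X` one has `𝒮_σδ = 𝒮_δσ`. -/
theorem stmt14 {X : Type*} (hX : Cardinal.mk X ≤ Cardinal.aleph0)
    (𝒮 : Set (Set X)) (hne : 𝒮.Nonempty) :
    ctblInters (ctblUnions 𝒮) = ctblUnions (ctblInters 𝒮) := by
  have : Countable X := Cardinal.mk_le_aleph0_iff.1 hX
  ext A
  constructor
  · rintro ⟨f, hf, rfl⟩
    choose s hs hfs using hf
    obtain ⟨c, hc⟩ := exists_iInter_iUnion_eq_iUnion_iInter s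
    exact ⟨fun k => ⋂ n, s n (c k n), fun k => ⟨_, fun n => hs n (c k n), rfl⟩,
      (Set.iInter_congr hfs).trans hc⟩
  · rintro ⟨f, hf, rfl⟩
    choose s hs hfs using hf
    obtain ⟨c, hc⟩ := exists_iUnion_iInter_eq_iInter_iUnion s
    exact ⟨fun k => ⋃ n, s n (c k n), fun k => ⟨_, fun n => hs n (c k n), rfl⟩,
      (Set.iUnion_congr hfs).trans hc⟩
end

section
/- Let X be a set of cardinality strictly greater than ℵ₀. Then there exists a nonempty class 𝒮 of subsets of X with 𝒮_σδ ≠ 𝒮_δσ, i.e. the class of countable intersections of countable unions of members of 𝒮 differs from the class of countable unions of countable intersections of members of 𝒮. -/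
/-- An uncountable type contains a sequence of distinct points and, disjoint from it, an
uncountable set that injects into Baire space. -/
theorem exists_injective_seq_and_uncountable_injOn {X : Type*}
    (hX : Cardinal.aleph0 < Cardinal.mk X) :
    ∃ (z : ℕ → X) (Y : Set X) (e : X → ℕ → ℕ), Function.Injective z ∧
      (∀ j, z j ∉ Y) ∧ ¬ Y.Countable ∧ Set.InjOn e Y := by
  have h1 : Cardinal.aleph 1 ≤ Cardinal.mk X := by
    rw [← Cardinal.succ_aleph0]
    exact Order.succ_le_of_lt hX
  obtain ⟨s, hs⟩ := Cardinal.le_mk_iff_exists_set.1 h1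
  have hsc : ¬ s.Countable := by
    rw [← Cardinal.le_aleph0_iff_set_countable, hs, not_le]
    exact Cardinal.aleph0_lt_aleph_one
  have hle : Cardinal.lift.{0} (Cardinal.mk s) ≤ Cardinal.lift (Cardinal.mk (ℕ → ℕ)) := by
    have hc : Cardinal.mk (ℕ → ℕ) = Cardinal.continuum := by simp
    rw [hs, hc]
    simpa using Cardinal.aleph_one_le_continuum
  obtain ⟨e⟩ := Cardinal.lift_mk_le'.1 hle
  have : Infinite X := Cardinal.infinite_iff.2 hX.le
  classical
  let z := Infinite.natEmbedding X
  refine ⟨z, s \ Set.range z, fun x => if h : x ∈ s then e ⟨x, h⟩ else 0, z.injective,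
    fun j h => h.2 ⟨j, rfl⟩, fun h => hsc ?_, ?_⟩
  · exact (h.union (Set.countable_range z)).mono fun x hx => by
      by_cases hz : x ∈ Set.range z
      · exact Or.inr hz
      · exact Or.inl ⟨hx, hz⟩
  · intro x hx y hy hxy
    simp only [hx.1, hy.1, dif_pos] at hxy
    exact congrArg Subtype.val (e.injective hxy)

/-- If `X` has cardinality strictly greater than `ℵ₀`, then there is
a nonempty class `𝒮` of subsets of `X` with `𝒮_σδ ≠ 𝒮_δσ`. -/
theorem stmt15 {X : Type*} (hX : Cardinal.aleph0 < Cardinal.mk X) :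
    ∃ 𝒮 : Set (Set X), 𝒮.Nonempty ∧
      ctblInters (ctblUnions 𝒮) ≠ ctblUnions (ctblInters 𝒮) := by
  obtain ⟨z, Y, e, hz, hzY, hY, he⟩ := exists_injective_seq_and_uncountable_injOn hX
  let A : ℕ × ℕ → Set X := fun p => {x | (∃ j, j ≠ p.1 ∧ z j = x) ∨ (x ∈ Y ∧ e x p.1 = p.2)}
  refine ⟨Set.range A, Set.range_nonempty A, fun heq => ?_⟩
  have hmem : Y ∈ ctblInters (ctblUnions (Set.range A)) := by
    refine ⟨fun n => ⋃ m, A (n, m), fun n => ⟨fun m => A (n, m), fun m => ⟨_, rfl⟩, rfl⟩, ?_⟩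
    ext x
    simp only [Set.mem_iInter, Set.mem_iUnion]
    constructor
    · exact fun hx n => ⟨e x n, Or.inr ⟨hx, rfl⟩⟩
    · intro h
      obtain ⟨_, ⟨j, _, rfl⟩ | ⟨hx, _⟩⟩ := h 0
      · obtain ⟨_, ⟨i, hi, hij⟩ | ⟨hx, _⟩⟩ := h j
        · exact absurd (hz hij) hi
        · exact hx
      · exact hx
  rw [heq] at hmem
  obtain ⟨F, hF, hYF⟩ := hmem
  choose f hf hFf using hF
  choose p hp using hf
  have hcol : ∀ k n, ∃ i, (p k i).1 = n := by
    intro k n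
    by_contra! hne
    refine hzY n ?_
    rw [hYF]
    refine Set.mem_iUnion.2 ⟨k, ?_⟩
    rw [hFf k]
    refine Set.mem_iInter.2 fun i => ?_
    rw [← hp k i]
    exact Or.inl ⟨n, (hne i).symm, rfl⟩
  have hval : ∀ k i, ∀ x ∈ Y, x ∈ F k → e x (p k i).1 = (p k i).2 := by
    intro k i x hx hxk
    rw [hFf k] at hxk
    have hxi := Set.mem_iInter.1 hxk i
    rw [← hp k i] at hxi
    obtain ⟨j, _, rfl⟩ | ⟨_, h⟩ := hxi
    · exact absurd hx (hzY j)
    · exact h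
  have hsub : ∀ k, (F k).Subsingleton := by
    intro k x hx y hy
    have hxY : x ∈ Y := hYF ▸ Set.mem_iUnion.2 ⟨k, hx⟩
    have hyY : y ∈ Y := hYF ▸ Set.mem_iUnion.2 ⟨k, hy⟩
    refine he hxY hyY (funext fun n => ?_)
    obtain ⟨i, rfl⟩ := hcol k n
    rw [hval k i x hxY hx, hval k i y hyY hy]
  exact hY (hYF ▸ Set.countable_iUnion fun k => (hsub k).countable)
end

section
/- Let X be a set and f : X → X a map without fixed points (f(x) ≠ x for all x ∈ X). Then there exist pairwise disjoint subsets X₁, X₂, X₃ of X with X = X₁ ∪ X₂ ∪ X₃ such that Xᵢ ∩ f(Xᵢ) = ∅ for i = 1, 2, 3 (where f(Xᵢ) denotes the image of Xᵢ under f). -/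
open Function in
/-- Two points are related when their forward orbits under `f` meet. -/
def orbitMeetSetoid {X : Type*} (f : X → X) : Setoid X where
  r x y := ∃ m n, f^[m] x = f^[n] y
  iseqv :=
    { refl := fun _ => ⟨0, 0, rfl⟩
      symm := fun ⟨m, n, h⟩ => ⟨n, m, h.symm⟩
      trans := by
        rintro x y z ⟨m, n, h⟩ ⟨p, q, h'⟩
        refine ⟨p + m, n + q, ?_⟩
        rw [iterate_add_apply, h, ← iterate_add_apply, add_comm p n, iterate_add_apply, h',
          ← iterate_add_apply] }

open Function in
theorem exists_coloring_of_reaches {X : Type*} (f : X → X) (hf : ∀ x, f x ≠ x) (p : X) :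
    ∃ c : X → ℕ, (∀ x, c x < 3) ∧ ∀ x, (∃ n, f^[n] x = p) → c (f x) ≠ c x := by
  classical
  let d : X → ℕ := fun x => sInf {n | f^[n] x = p}
  refine ⟨fun x => if x = p then 2 else d x % 2, fun x => ?_, fun x hx => ?_⟩
  · dsimp only
    split_ifs <;> omega
  · by_cases hxp : x = p
    · subst hxp
      simp only [hf, if_true, if_false]
      omega
    · have hdx : f^[d x] x = p := Nat.sInf_mem (s := {n | f^[n] x = p}) hx
      obtain ⟨k, hk⟩ : ∃ k, d x = k + 1 := by
        refine Nat.exists_eq_succ_of_ne_zero fun h0 => hxp ?_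
        simpa [h0] using hdx
      have hfk : f^[k] (f x) = p := by rwa [hk, iterate_succ_apply] at hdx
      have hle : d (f x) ≤ k := Nat.sInf_le hfk
      have hdfx : f^[d (f x)] (f x) = p :=
        Nat.sInf_mem (s := {n | f^[n] (f x) = p}) ⟨k, hfk⟩
      have hge : d x ≤ d (f x) + 1 := Nat.sInf_le (by
        rwa [Set.mem_ofPred_eq, iterate_succ_apply])
      simp only [hxp, if_false]
      split_ifs <;> omega

open Function in
theorem exists_coloring_of_injective_orbit {X : Type*} (f : X → X) (r : X)
    (hr : Injective fun n => f^[n] r) :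
    ∃ c : X → ℕ, (∀ x, c x < 3) ∧ ∀ x, (∃ m n, f^[m] x = f^[n] r) → c (f x) ≠ c x := by
  classical
  have key : ∀ x, ∃ m n, (∃ m n, f^[m] x = f^[n] r) → f^[m] x = f^[n] r := fun x => by
    by_cases h : ∃ m n, f^[m] x = f^[n] r
    · obtain ⟨m, n, h⟩ := h
      exact ⟨m, n, fun _ => h⟩
    · exact ⟨0, 0, fun h' => absurd h' h⟩
  choose m n hmn using key
  refine ⟨fun x => (m x + n x) % 2, fun x => by dsimp only; omega, fun x hx => ?_⟩
  have h₁ := hmn x hx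
  have h₂ := hmn (f x) (by
    obtain ⟨a, b, h⟩ := hx
    refine ⟨a, b + 1, ?_⟩
    rw [← iterate_succ_apply, iterate_succ_apply', h, iterate_succ_apply'])
  have h : n x + m (f x) + 1 = n (f x) + m x := hr (by
    change f^[n x + m (f x) + 1] r = f^[n (f x) + m x] r
    rw [show n x + m (f x) + 1 = (m (f x) + 1) + n x by ring, iterate_add_apply, ← h₁,
      ← iterate_add_apply, add_comm (n (f x)), iterate_add_apply (f := f) (m x), ← h₂,
      ← iterate_succ_apply, ← iterate_add_apply]
    congr 1
    omega)
  dsimp only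
  omega

open Function in
theorem exists_coloring_of_orbit_meets {X : Type*} (f : X → X) (hf : ∀ x, f x ≠ x) (r : X) :
    ∃ c : X → ℕ, (∀ x, c x < 3) ∧ ∀ x, (∃ m n, f^[m] x = f^[n] r) → c (f x) ≠ c x := by
  by_cases hr : Injective fun n => f^[n] r
  · exact exists_coloring_of_injective_orbit f r hr
  · obtain ⟨i, k, hk, hp⟩ : ∃ i k, 0 < k ∧ IsPeriodicPt f k (f^[i] r) := by
      simp only [Injective, not_forall] at hr
      obtain ⟨a, b, hab, hne⟩ := hr
      rcases lt_or_gt_of_ne hne with h | h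
      · refine ⟨a, b - a, by omega, ?_⟩
        rw [IsPeriodicPt, IsFixedPt, ← iterate_add_apply, Nat.sub_add_cancel h.le, hab]
      · refine ⟨b, a - b, by omega, ?_⟩
        rw [IsPeriodicPt, IsFixedPt, ← iterate_add_apply, Nat.sub_add_cancel h.le, hab]
    obtain ⟨c, hc, hcx⟩ := exists_coloring_of_reaches f hf (f^[i] r)
    refine ⟨c, hc, fun x ⟨m, n, h⟩ => hcx x ⟨(k * n - n + i) + m, ?_⟩⟩
    have hle : n ≤ k * n := Nat.le_mul_of_pos_left n hk
    rw [iterate_add_apply, h, ← iterate_add_apply,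
      show k * n - n + i + n = k * n + i by omega, iterate_add_apply]
    exact hp.mul_const n

theorem exists_three_coloring {X : Type*} (f : X → X) (hf : ∀ x, f x ≠ x) :
    ∃ c : X → ℕ, (∀ x, c x < 3) ∧ ∀ x, c (f x) ≠ c x := by
  choose c hc hcx using exists_coloring_of_orbit_meets f hf
  let rep : X → X := fun x => (Quotient.mk (orbitMeetSetoid f) x).out
  have hrep : ∀ x, rep (f x) = rep x := fun x =>
    congrArg Quotient.out (Quotient.sound (s := orbitMeetSetoid f) ⟨0, 1, rfl⟩)
  refine ⟨fun x => c (rep x) x, fun x => hc _ _, fun x => ?_⟩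
  dsimp only
  rw [hrep]
  exact hcx _ _ ((orbitMeetSetoid f).symm (Quotient.mk_out (s := orbitMeetSetoid f) x))

/-- (Katětov) If `f : X → X` has no fixed point, then `X` can be
decomposed into three pairwise disjoint sets `X₁, X₂, X₃` covering `X` with
`Xᵢ ∩ f(Xᵢ) = ∅` for `i = 1, 2, 3`. -/
theorem stmt16 {X : Type*} (f : X → X) (hf : ∀ x, f x ≠ x) :
    ∃ X₁ X₂ X₃ : Set X,
      Disjoint X₁ X₂ ∧ Disjoint X₁ X₃ ∧ Disjoint X₂ X₃ ∧
      X₁ ∪ X₂ ∪ X₃ = Set.univ ∧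
      X₁ ∩ (f '' X₁) = ∅ ∧ X₂ ∩ (f '' X₂) = ∅ ∧ X₃ ∩ (f '' X₃) = ∅ := by
  obtain ⟨c, hc, hcf⟩ := exists_three_coloring f hf
  have hdisj : ∀ i j, i ≠ j → Disjoint (c ⁻¹' {i}) (c ⁻¹' {j}) := fun i j hij =>
    Disjoint.preimage c (Set.disjoint_singleton.2 hij)
  have hinter : ∀ i, c ⁻¹' {i} ∩ f '' (c ⁻¹' {i}) = ∅ := fun i => by
    rw [Set.eq_empty_iff_forall_notMem]
    rintro _ ⟨h, x, hx, rfl⟩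
    exact hcf x (Eq.trans h (Eq.symm hx))
  refine ⟨c ⁻¹' {0}, c ⁻¹' {1}, c ⁻¹' {2}, hdisj _ _ (by decide), hdisj _ _ (by decide),
    hdisj _ _ (by decide), Set.eq_univ_of_forall fun x => ?_, hinter 0, hinter 1, hinter 2⟩
  have := hc x
  simp only [Set.mem_union, Set.mem_preimage, Set.mem_singleton_iff]
  omega
end

section
/- There exists a function f assigning to each two-element subset {x, y} of ℝ one of two colors such that no subset S of ℝ of cardinality at least ℵ₁ is homogeneous for f, i.e. for every S ⊆ ℝ with |S| ≥ ℵ₁ and for each color c, there is a two-element subset of S whose f-value is not c. (In particular, for every finite partition of the two-element subsets of a set of cardinality 2^{ℵ₀} there need be no piece containing all pairs from some set of cardinality ℵ₁.) -/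
open Set Topology in
theorem Set.IsWF.countable_of_secondCountableTopology {α : Type*} [LinearOrder α]
    [TopologicalSpace α] [OrderTopology α] [SecondCountableTopology α] {s : Set α}
    (hs : s.IsWF) : s.Countable := by
  suffices h : s ⊆ {x ∈ s | 𝓝[s ∩ Ioi x] x = ⊥} from
    countable_setOfPred_isolated_right_within.mono h
  intro x hx
  refine ⟨hx, ?_⟩
  rcases (s ∩ Ioi x).eq_empty_or_nonempty with h | h
  · simp [h]
  · have hwf : (s ∩ Ioi x).IsWF := hs.mono inter_subset_left
    have hlt : x < hwf.min h := (hwf.min_mem h).2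
    rw [← Filter.empty_mem_iff_bot, mem_nhdsWithin]
    exact ⟨Iio (hwf.min h), isOpen_Iio, hlt, fun y hy => hwf.not_lt_min h hy.2 hy.1⟩

/-- (Sierpiński) There is a two-coloring of the two-element subsets
of `ℝ` (given by a symmetric function `f : ℝ → ℝ → Bool`, evaluated on pairs of
distinct points) such that no set `S ⊆ ℝ` of cardinality at least `ℵ₁` is homogeneous:
for every such `S` and every color `c` there is a pair of distinct points of `S` whose
color is not `c`. -/
theorem stmt18 :
    ∃ f : ℝ → ℝ → Bool, (∀ x y, f x y = f y x) ∧
      ∀ S : Set ℝ, Cardinal.aleph 1 ≤ Cardinal.mk S →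
        ∀ c : Bool, ∃ x ∈ S, ∃ y ∈ S, x ≠ y ∧ f x y ≠ c := by
  classical
  let r : ℝ → ℝ → Prop := WellOrderingRel
  have hasymm : ∀ x y, r x y → ¬ r y x := fun x y => asymm_of r
  have htri : ∀ x y, x ≠ y → r x y ∨ r y x := fun x y h => by
    rcases trichotomous_of r x y with h' | h' | h'
    exacts [.inl h', (h h').elim, .inr h']
  have hwf : WellFounded r := IsWellFounded.wf
  refine ⟨fun x y => decide (x < y ↔ r x y), fun x y => ?_, fun S hS c => ?_⟩
  · rcases lt_trichotomy x y with h | rfl | h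
    · have := htri x y h.ne
      have := hasymm x y
      simp only [h, h.not_gt, decide_eq_decide]
      tauto
    · rfl
    · have := htri x y h.ne'
      have := hasymm x y
      simp only [h, h.not_gt, decide_eq_decide]
      tauto
  · by_contra! hc
    refine hS.not_gt (Cardinal.lt_aleph_one_iff.2 (Cardinal.le_aleph0_iff_set_countable.2 ?_))
    cases c
    · have hgt : S.WellFoundedOn (· > ·) := (hwf.wellFoundedOn (s := S)).mono'
        fun x hx y hy hxy => by
          have h := hc x hx y hy (ne_of_gt hxy)
          simp only [decide_eq_false_iff_not, not_lt_of_gt hxy, false_iff, not_not] at h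
          exact h
      exact Set.IsWF.countable_of_secondCountableTopology (α := ℝᵒᵈ) (s := S) hgt
    · have hlt : S.IsWF := (hwf.wellFoundedOn (s := S)).mono'
        fun x hx y hy hxy => (of_decide_eq_true (hc x hx y hy (ne_of_lt hxy))).1 hxy
      exact hlt.countable_of_secondCountableTopology
end

section
/- The continuum hypothesis (2^{ℵ₀} = ℵ₁) holds if and only if the plane ℝ × ℝ can be partitioned into two disjoint sets X and Y with X ∪ Y = ℝ × ℝ such that for every y ∈ ℝ the horizontal section {x ∈ ℝ : (x, y) ∈ X} is finite or countable, and for every x ∈ ℝ the vertical section {y ∈ ℝ : (x, y) ∈ Y} is finite or countable. Moreover (Tietze), the plane can NOT be partitioned into two disjoint sets X and Y covering ℝ × ℝ such that for every y ∈ ℝ the section {x ∈ ℝ : (x, y) ∈ X} is finite and for every x ∈ ℝ the section {y ∈ ℝ : (x, y) ∈ Y} is finite or countable. -/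
/-- If `#α ≤ ℵ₁`, then `α × α` splits into two parts with countable horizontal, respectively
vertical, sections. -/
theorem exists_countable_sections_of_mk_le_aleph_one {α : Type*}
    (h : Cardinal.mk α ≤ Cardinal.aleph 1) :
    ∃ A B : Set (α × α), Disjoint A B ∧ A ∪ B = Set.univ ∧
      (∀ y : α, {x : α | (x, y) ∈ A}.Countable) ∧
      (∀ x : α, {y : α | (x, y) ∈ B}.Countable) := by
  obtain ⟨_, _, hα⟩ := Cardinal.exists_ord_eq_type_lt α
  have hIio (i : α) : (Set.Iio i).Countable := by
    rw [← Cardinal.le_aleph0_iff_set_countable, ← Cardinal.lt_aleph_one_iff]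
    exact (Cardinal.mk_Iio_lt i hα).trans_le h
  refine ⟨{p | p.1 < p.2}, {p | p.2 ≤ p.1}, ?_, ?_, fun y => hIio y, fun x => ?_⟩
  · exact Set.disjoint_left.2 fun p hp hp' => hp.not_ge hp'
  · exact Set.eq_univ_of_forall fun p => lt_or_ge p.1 p.2
  · change (Set.Iic x).Countable
    rw [← Set.Iio_insert]
    exact (hIio x).insert _

/-- If the square of `α` is covered by two sets with countable horizontal, respectively
vertical, sections, then `#α ≤ ℵ₁`. -/
theorem mk_le_aleph_one_of_countable_sections {α : Type*} {A B : Set (α × α)}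
    (hAB : A ∪ B = Set.univ) (hA : ∀ y : α, {x : α | (x, y) ∈ A}.Countable)
    (hB : ∀ x : α, {y : α | (x, y) ∈ B}.Countable) :
    Cardinal.mk α ≤ Cardinal.aleph 1 := by
  by_contra! h
  obtain ⟨S, hS⟩ := Cardinal.le_mk_iff_exists_set.1 h.le
  have hU : Cardinal.mk (⋃ y ∈ S, {x : α | (x, y) ∈ A} : Set α) ≤ Cardinal.aleph 1 := by
    have hsup : ⨆ y : S, Cardinal.mk {x : α | (x, y.1) ∈ A} ≤ Cardinal.aleph 1 :=
      ciSup_le' fun y => (hA y.1).le_aleph0.trans (Cardinal.aleph0_le_aleph 1)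
    calc
      _ ≤ _ := Cardinal.mk_biUnion_le _ S
      _ ≤ Cardinal.aleph 1 * Cardinal.aleph 1 := mul_le_mul' hS.le hsup
      _ = Cardinal.aleph 1 := Cardinal.mul_eq_self (Cardinal.aleph0_le_aleph 1)
  obtain ⟨x, hx⟩ : ∃ x, x ∉ ⋃ y ∈ S, {x : α | (x, y) ∈ A} := by
    by_contra! hx
    rw [Set.eq_univ_of_forall hx, Cardinal.mk_univ] at hU
    exact hU.not_gt h
  have hSB : S ⊆ {y | (x, y) ∈ B} := fun y hy =>
    (hAB.ge (Set.mem_univ (x, y))).resolve_left fun hxy => hx (Set.mem_biUnion hy hxy)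
  have hle : Cardinal.mk S ≤ Cardinal.aleph0 := ((hB x).mono hSB).le_aleph0
  exact (Cardinal.lt_aleph_one_iff.2 hle).ne hS

/-- The square of a type covered by two sets with finite horizontal, respectively countable
vertical, sections is the square of a countable type. -/
theorem countable_of_finite_of_countable_sections {α : Type*} {A B : Set (α × α)}
    (hAB : A ∪ B = Set.univ) (hA : ∀ y : α, {x : α | (x, y) ∈ A}.Finite)
    (hB : ∀ x : α, {y : α | (x, y) ∈ B}.Countable) : Countable α := by
  by_contra h
  have : Infinite α := not_finite_iff_infinite.1 fun _ => h inferInstance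
  let f := Infinite.natEmbedding α
  obtain ⟨y, hy⟩ : ∃ y, y ∉ ⋃ n, {y : α | (f n, y) ∈ B} := by
    by_contra! hy
    refine h (Set.countable_univ_iff.1 ?_)
    rw [← Set.eq_univ_of_forall hy]
    exact Set.countable_iUnion fun n => hB (f n)
  refine Set.infinite_range_of_injective f.injective ((hA y).subset ?_)
  rintro _ ⟨n, rfl⟩
  exact (hAB.ge (Set.mem_univ (f n, y))).resolve_right fun hn => hy (Set.mem_iUnion.2 ⟨n, hn⟩)

/-- The continuum hypothesis, in any universe, in terms of the cardinality of `ℝ`. -/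
theorem two_power_aleph0_eq_aleph_one_iff_mk_real_le :
    (2 : Cardinal) ^ Cardinal.aleph0 = Cardinal.aleph 1 ↔
      Cardinal.mk ℝ ≤ Cardinal.aleph 1 := by
  rw [Cardinal.two_power_aleph0, Cardinal.mk_real, ← Cardinal.lift_continuum.{_, 0},
    ← Ordinal.lift_one.{0, _}, ← Cardinal.lift_aleph, Cardinal.lift_inj]
  exact ⟨le_of_eq, fun h => h.antisymm Cardinal.aleph_one_le_continuum⟩

/-- (Sierpiński; Tietze) The continuum hypothesis `2 ^ ℵ₀ = ℵ₁` holds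
if and only if the plane is the union of two disjoint sets `A` and `B` such that every
horizontal section `{x : (x, y) ∈ A}` of `A` is finite or countable and every vertical
section `{y : (x, y) ∈ B}` of `B` is finite or countable.  Moreover, the plane can NOT
be partitioned into two disjoint sets `A` and `B` covering it such that every
horizontal section of `A` is finite and every vertical section of `B` is finite or
countable. -/
theorem stmt19 :
    (((2 : Cardinal) ^ Cardinal.aleph0 = Cardinal.aleph 1) ↔
      ∃ A B : Set (ℝ × ℝ), Disjoint A B ∧ A ∪ B = Set.univ ∧
        (∀ y : ℝ, {x : ℝ | (x, y) ∈ A}.Countable) ∧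
        (∀ x : ℝ, {y : ℝ | (x, y) ∈ B}.Countable)) ∧
    ¬ (∃ A B : Set (ℝ × ℝ), Disjoint A B ∧ A ∪ B = Set.univ ∧
        (∀ y : ℝ, {x : ℝ | (x, y) ∈ A}.Finite) ∧
        (∀ x : ℝ, {y : ℝ | (x, y) ∈ B}.Countable)) := by
  refine ⟨two_power_aleph0_eq_aleph_one_iff_mk_real_le.trans
    ⟨exists_countable_sections_of_mk_le_aleph_one, ?_⟩, ?_⟩
  · rintro ⟨A, B, -, hAB, hA, hB⟩
    exact mk_le_aleph_one_of_countable_sections hAB hA hB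
  · rintro ⟨A, B, -, hAB, hA, hB⟩
    have := countable_of_finite_of_countable_sections hAB hA hB
    exact not_countable (α := ℝ) this
end
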